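/- arXiv:2209.11533 — 6 statements merged into one kernel-verified Lean document; each statement's English description precedes it below -/
import Mathlib

section
/- Let E be a real finite-dimensional normed space (the parameter space) and θ₀ ∈ E. Under the parametrized mixture setup with all stated positivity, normalization, differentiability and differentiation-under-the-integral-sign assumptions at θ₀, and with the auxiliary conditional fixed to the responsibilities of the model at θ₀ (τ o x = w θ₀ o · c θ₀ o x / q θ₀ x), the derivative at θ₀ of the ELBO J equals the derivative at θ₀ of the lower bound J̃: fderiv ℝ J θ₀ = fderiv ℝ (fun θ => J̃ θ) θ₀. (Theorem 1, gradient form / Eq. (11).) -/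
open MeasureTheory

/-- Differentiation under the integral sign is valid at `θ₀` for `θ ↦ ∫ x, g θ x ∂μ`:
the map is differentiable at `θ₀` with derivative equal to the (Bochner) integral of the
pointwise `θ`-derivative of the integrand, the latter being integrable. -/
def DiffUnderIntegral {E : Type*} [NormedAddCommGroup E] [NormedSpace ℝ E]
    {X : Type*} [MeasurableSpace X] (μ : Measure X) (g : E → X → ℝ) (θ₀ : E) : Prop :=
  ∃ D : X → (E →L[ℝ] ℝ), Integrable D μ ∧
    (∀ᵐ x ∂μ, HasFDerivAt (fun θ => g θ x) (D x) θ₀) ∧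
    HasFDerivAt (fun θ => ∫ x, g θ x ∂μ) (∫ x, D x ∂μ) θ₀

/-- The Gibbs inequality for positive weights `a` with total mass `∑ i, a i` and a positive
probability vector `t`. -/
theorem sum_mul_log_sub_log_le {ι : Type*} [Fintype ι] [Nonempty ι] {a t : ι → ℝ}
    (ha : ∀ i, 0 < a i) (ht : ∀ i, 0 < t i) (hsum : ∑ i, t i = 1) :
    ∑ i, a i * (Real.log (t i) - Real.log (a i)) ≤ -((∑ i, a i) * Real.log (∑ i, a i)) := by
  set q := ∑ i, a i with hq
  have hqpos : 0 < q := Finset.sum_pos (fun i _ => ha i) Finset.univ_nonempty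
  have hterm : ∀ i, a i * (Real.log (t i) - Real.log (a i)) ≤
      q * t i - a i - a i * Real.log q := by
    intro i
    have hlog := Real.log_le_sub_one_of_pos (div_pos (mul_pos hqpos (ht i)) (ha i))
    rw [Real.log_div (mul_pos hqpos (ht i)).ne' (ha i).ne',
      Real.log_mul hqpos.ne' (ht i).ne'] at hlog
    have hmul := mul_le_mul_of_nonneg_left hlog (ha i).le
    have hcancel : a i * (q * t i / a i - 1) = q * t i - a i := by
      field_simp [(ha i).ne']
    linarith
  refine (Finset.sum_le_sum fun i _ => hterm i).trans_eq ?_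
  rw [Finset.sum_sub_distrib, Finset.sum_sub_distrib, ← Finset.mul_sum, ← Finset.sum_mul,
    hsum, ← hq]
  ring

/-- The Gibbs inequality is an equality at the normalized weights. -/
theorem sum_mul_log_normalize_sub_log {ι : Type*} [Fintype ι] [Nonempty ι] {a : ι → ℝ}
    (ha : ∀ i, 0 < a i) :
    ∑ i, a i * (Real.log (a i / ∑ j, a j) - Real.log (a i)) =
      -((∑ i, a i) * Real.log (∑ i, a i)) := by
  have hqpos : 0 < ∑ i, a i := Finset.sum_pos (fun i _ => ha i) Finset.univ_nonempty
  simp_rw [fun i => Real.log_div (ha i).ne' hqpos.ne']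
  rw [Finset.sum_mul, ← Finset.sum_neg_distrib]
  exact Finset.sum_congr rfl fun i _ => by ring

/-- Theorem 1 (gradient form): with the auxiliary conditional fixed to the responsibilities
of the model at `θ₀`, the derivative of the ELBO `J` at `θ₀` equals the derivative of the
lower bound `J̃` at `θ₀`. -/
theorem fderiv_elbo_eq_fderiv_lowerBound
    {X : Type*} [MeasurableSpace X] (μ : Measure X)
    {O : Type*} [Fintype O] [Nonempty O]
    {E : Type*} [NormedAddCommGroup E] [NormedSpace ℝ E] [FiniteDimensional ℝ E]
    (θ₀ : E)
    (w : E → O → ℝ) (c : E → O → X → ℝ) (ρ : X → ℝ)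
    (q : E → X → ℝ) (hq : ∀ θ x, q θ x = ∑ o, w θ o * c θ o x)
    (hρ : Measurable ρ)
    -- positivity, normalization and measurability for θ in a neighborhood of θ₀
    (hsetup : ∀ᶠ θ in nhds θ₀,
      (∀ o, 0 < w θ o) ∧ (∑ o, w θ o = 1) ∧
      (∀ o, Measurable (c θ o)) ∧ (∀ o x, 0 < c θ o x) ∧
      (∀ o, ∫ x, c θ o x ∂μ = 1))
    -- pointwise differentiability at θ₀
    (hwdiff : ∀ o, DifferentiableAt ℝ (fun θ => w θ o) θ₀)
    (hcdiff : ∀ o x, DifferentiableAt ℝ (fun θ => c θ o x) θ₀)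
    -- the auxiliary conditional: responsibilities of the model at θ₀
    (τ : O → X → ℝ) (hτ : ∀ o x, τ o x = w θ₀ o * c θ₀ o x / q θ₀ x)
    -- the ELBO J and the lower bound J̃
    (J Jt : E → ℝ)
    (hJ : ∀ θ, J θ =
      (∑ o, w θ o * ∫ x, c θ o x * ρ x ∂μ) - ∫ x, q θ x * Real.log (q θ x) ∂μ)
    (hJt : ∀ θ, Jt θ = ∑ o, w θ o *
      ((∫ x, c θ o x * (ρ x + Real.log (τ o x) - Real.log (c θ o x)) ∂μ) -
        Real.log (w θ o)))
    -- all integrals appearing exist (for θ in a neighborhood of θ₀)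
    (hint1 : ∀ᶠ θ in nhds θ₀, ∀ o, Integrable (fun x => c θ o x * ρ x) μ)
    (hint2 : ∀ᶠ θ in nhds θ₀, Integrable (fun x => q θ x * Real.log (q θ x)) μ)
    (hint3 : ∀ᶠ θ in nhds θ₀, ∀ o,
      Integrable (fun x => c θ o x * (ρ x + Real.log (τ o x) - Real.log (c θ o x))) μ)
    -- differentiation under the integral sign is valid at θ₀ for each integral term
    (hdui1 : ∀ o, DiffUnderIntegral μ (fun θ x => c θ o x * ρ x) θ₀)
    (hdui2 : DiffUnderIntegral μ (fun θ x => q θ x * Real.log (q θ x)) θ₀)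
    (hdui3 : ∀ o, DiffUnderIntegral μ
      (fun θ x => c θ o x * (ρ x + Real.log (τ o x) - Real.log (c θ o x))) θ₀) :
    fderiv ℝ J θ₀ = fderiv ℝ Jt θ₀ := by
  have hJd : DifferentiableAt ℝ J θ₀ := by
    rw [funext hJ]
    obtain ⟨_, -, -, h2⟩ := hdui2
    refine DifferentiableAt.sub (DifferentiableAt.fun_sum fun o _ => (hwdiff o).mul ?_)
      h2.differentiableAt
    obtain ⟨_, -, -, h1⟩ := hdui1 o
    exact h1.differentiableAt
  have hJtd : DifferentiableAt ℝ Jt θ₀ := by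
    rw [funext hJt]
    refine DifferentiableAt.fun_sum fun o _ => (hwdiff o).mul (DifferentiableAt.sub ?_
      ((hwdiff o).log (hsetup.self_of_nhds.1 o).ne'))
    obtain ⟨_, -, -, h3⟩ := hdui3 o
    exact h3.differentiableAt
  have hcpos₀ := hsetup.self_of_nhds.2.2.2.1
  have hwpos₀ := hsetup.self_of_nhds.1
  have hqpos₀ : ∀ x, 0 < q θ₀ x := fun x => by
    rw [hq]
    exact Finset.sum_pos (fun o _ => mul_pos (hwpos₀ o) (hcpos₀ o x)) Finset.univ_nonempty
  have hτpos : ∀ o x, 0 < τ o x := fun o x => by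
    rw [hτ]
    exact div_pos (mul_pos (hwpos₀ o) (hcpos₀ o x)) (hqpos₀ x)
  have hτsum : ∀ x, ∑ o, τ o x = 1 := fun x => by
    simp_rw [hτ]
    exact (Finset.sum_div ..).symm.trans (by rw [← hq, div_self (hqpos₀ x).ne'])
  -- Near `θ₀`, the gap `J - Jt` is the integral of the pointwise gap in the Gibbs inequality.
  have hgap : ∀ᶠ θ in nhds θ₀, J θ - Jt θ =
      ∫ x, (-(q θ x * Real.log (q θ x)) -
        ∑ o, w θ o * c θ o x * (Real.log (τ o x) - Real.log (w θ o * c θ o x))) ∂μ := by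
    filter_upwards [hsetup, hint1, hint2, hint3] with θ ⟨hw, _, _, hc, hc1⟩ i1 i2 i3
    have ic : ∀ o, Integrable (c θ o) μ := fun o =>
      Integrable.of_integral_ne_zero (by rw [hc1 o]; exact one_ne_zero)
    have hsplit : ∀ x, -(q θ x * Real.log (q θ x)) -
        ∑ o, w θ o * c θ o x * (Real.log (τ o x) - Real.log (w θ o * c θ o x)) =
        ((∑ o, w θ o * (c θ o x * ρ x)) - q θ x * Real.log (q θ x)) -
        ∑ o, w θ o * (c θ o x * (ρ x + Real.log (τ o x) - Real.log (c θ o x)) -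
          c θ o x * Real.log (w θ o)) := by
      intro x
      have hsum : ∑ o, w θ o * c θ o x * (Real.log (τ o x) - Real.log (w θ o * c θ o x)) =
          (∑ o, w θ o * (c θ o x * (ρ x + Real.log (τ o x) - Real.log (c θ o x)) -
            c θ o x * Real.log (w θ o))) - ∑ o, w θ o * (c θ o x * ρ x) := by
        rw [← Finset.sum_sub_distrib]
        refine Finset.sum_congr rfl fun o _ => ?_
        rw [Real.log_mul (hw o).ne' (hc o x).ne']
        ring
      rw [hsum]
      ring
    have iA : ∀ o, Integrable (fun x => w θ o * (c θ o x * ρ x)) μ :=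
      fun o => (i1 o).const_mul _
    have iC : ∀ o, Integrable (fun x => c θ o x * Real.log (w θ o)) μ :=
      fun o => (ic o).mul_const _
    have iB : ∀ o, Integrable (fun x => w θ o *
        (c θ o x * (ρ x + Real.log (τ o x) - Real.log (c θ o x)) -
          c θ o x * Real.log (w θ o))) μ :=
      fun o => ((i3 o).sub (iC o)).const_mul _
    have iJ : Integrable (fun x => (∑ o, w θ o * (c θ o x * ρ x)) -
        q θ x * Real.log (q θ x)) μ :=
      (integrable_finsetSum _ fun o _ => iA o).sub i2
    simp_rw [hsplit]
    rw [integral_sub iJ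
        (integrable_finsetSum _ fun o _ => iB o),
      integral_sub (integrable_finsetSum _ fun o _ => iA o) i2,
      integral_finsetSum _ fun o _ => iA o, integral_finsetSum _ fun o _ => iB o, hJ, hJt]
    congr 1
    · simp_rw [integral_const_mul]
    · refine Finset.sum_congr rfl fun o _ => ?_
      rw [integral_const_mul, integral_sub (i3 o) (iC o), integral_mul_const, hc1 o, one_mul]
  have hzero : J θ₀ - Jt θ₀ = 0 := by
    rw [hgap.self_of_nhds]
    refine integral_eq_zero_of_ae (Filter.Eventually.of_forall fun x => ?_)
    have heq := sum_mul_log_normalize_sub_log fun o => mul_pos (hwpos₀ o) (hcpos₀ o x)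
    simp only [← hq, ← hτ] at heq
    simp only [heq, sub_self, Pi.zero_apply]
  have hmin : IsLocalMin (fun θ => J θ - Jt θ) θ₀ := by
    filter_upwards [hgap, hsetup] with θ hθ ⟨hw, _, _, hc, _⟩
    rw [hzero, hθ]
    refine integral_nonneg fun x => sub_nonneg.2 ?_
    rw [hq]
    exact sum_mul_log_sub_log_le (fun o => mul_pos (hw o) (hc o x)) (hτpos · x) (hτsum x)
  have hfd := hmin.fderiv_eq_zero
  rw [fderiv_fun_sub hJd hJtd] at hfd
  exact sub_eq_zero.1 hfd
end

section
/- Decomposition of the lower bound: under the finite mixture setup, for any auxiliary conditional τ, the lower bound satisfies J̃(τ) = J − ∫ q x · ( ∑_o r o x · log (r o x / τ o x) ) dμ, where r o x = w o · c o x / q x are the responsibilities of the mixture; i.e., J̃(τ) equals the ELBO minus the expected (under the mixture) Kullback–Leibler divergence from the responsibilities to the auxiliary conditional. -/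
open MeasureTheory

/-- Pointwise form of the decomposition: multiplying the Kullback–Leibler divergence from the
responsibilities `a o / ∑ o, a o` to `t` by the total mass `∑ o, a o`. -/
theorem sum_mul_sum_div_mul_log_div {O : Type*} [Fintype O] [Nonempty O] {a t : O → ℝ}
    (ha : ∀ o, 0 < a o) (ht : ∀ o, 0 < t o) :
    (∑ o, a o) * ∑ o, a o / (∑ o, a o) * Real.log (a o / (∑ o, a o) / t o)
      = ∑ o, a o * (Real.log (a o) - Real.log (t o)) - (∑ o, a o) * Real.log (∑ o, a o) := by
  have hpos : 0 < ∑ o, a o := Finset.sum_pos (fun o _ => ha o) Finset.univ_nonempty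
  generalize hs : ∑ o, a o = s at hpos ⊢
  have hlog : s * Real.log s = ∑ o, a o * Real.log s := by rw [← Finset.sum_mul, hs]
  rw [hlog, Finset.mul_sum, ← Finset.sum_sub_distrib]
  refine Finset.sum_congr rfl fun o _ => ?_
  rw [Real.log_div (div_pos (ha o) hpos).ne' (ht o).ne', Real.log_div (ha o).ne' hpos.ne']
  field_simp
  ring

/-- Decomposition of the lower bound: for any auxiliary conditional `τ`,
`J̃(τ) = J − ∫ q x · (∑ o, r o x · log (r o x / τ o x)) dμ`, i.e. the lower bound equals the
ELBO minus the expected KL divergence from the responsibilities to the auxiliary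
conditional. -/
theorem lowerBound_eq_elbo_sub_expected_klDiv
    {X : Type*} [MeasurableSpace X] (μ : Measure X)
    {O : Type*} [Fintype O] [Nonempty O]
    (w : O → ℝ) (c : O → X → ℝ) (ρ : X → ℝ) (τ : O → X → ℝ)
    -- finite mixture model
    (hwpos : ∀ o, 0 < w o) (hwsum : ∑ o, w o = 1)
    (hcmeas : ∀ o, Measurable (c o)) (hcpos : ∀ o x, 0 < c o x)
    (hcnorm : ∀ o, ∫ x, c o x ∂μ = 1)
    (hρ : Measurable ρ)
    -- mixture density and responsibilities
    (q : X → ℝ) (hq : ∀ x, q x = ∑ o, w o * c o x)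
    (r : O → X → ℝ) (hr : ∀ o x, r o x = w o * c o x / q x)
    -- auxiliary conditional
    (hτmeas : ∀ o, Measurable (τ o)) (hτpos : ∀ o x, 0 < τ o x)
    (hτsum : ∀ x, ∑ o, τ o x = 1)
    -- all integrals appearing exist
    (hintc : ∀ o, Integrable (c o) μ)
    (hint1 : ∀ o, Integrable (fun x => c o x * ρ x) μ)
    (hint2 : Integrable (fun x => q x * Real.log (q x)) μ)
    (hint3 : ∀ o, Integrable
      (fun x => c o x * (ρ x + Real.log (τ o x) - Real.log (c o x))) μ)
    (hint4 : Integrable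
      (fun x => q x * ∑ o, r o x * Real.log (r o x / τ o x)) μ) :
    (∑ o, w o * ((∫ x, c o x * (ρ x + Real.log (τ o x) - Real.log (c o x)) ∂μ)
        - Real.log (w o)))
      = ((∑ o, w o * ∫ x, c o x * ρ x ∂μ) - ∫ x, q x * Real.log (q x) ∂μ)
        - ∫ x, q x * (∑ o, r o x * Real.log (r o x / τ o x)) ∂μ := by
  have hlower : ∀ o, w o * ((∫ x, c o x * (ρ x + Real.log (τ o x) - Real.log (c o x)) ∂μ)
      - Real.log (w o))
      = ∫ x, w o * (c o x * (ρ x + Real.log (τ o x) - Real.log (c o x))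
        - c o x * Real.log (w o)) ∂μ := fun o => by
    rw [integral_const_mul, integral_sub (hint3 o) ((hintc o).mul_const _), integral_mul_const,
      hcnorm, one_mul]
  have hreward : ∑ o, w o * ∫ x, c o x * ρ x ∂μ = ∫ x, ∑ o, w o * (c o x * ρ x) ∂μ := by
    rw [integral_finsetSum _ fun o _ => (hint1 o).const_mul _]
    simp only [integral_const_mul]
  have hint_reward : Integrable (fun x => ∑ o, w o * (c o x * ρ x)) μ :=
    integrable_finsetSum _ fun o _ => (hint1 o).const_mul _
  have hint_elbo : Integrable (fun x => ∑ o, w o * (c o x * ρ x) - q x * Real.log (q x)) μ :=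
    hint_reward.sub hint2
  have hint_lower : ∀ o, Integrable (fun x => w o *
      (c o x * (ρ x + Real.log (τ o x) - Real.log (c o x)) - c o x * Real.log (w o))) μ :=
    fun o => ((hint3 o).sub ((hintc o).mul_const _)).const_mul _
  rw [Finset.sum_congr rfl fun o _ => hlower o, ← integral_finsetSum _ fun o _ => hint_lower o,
    hreward, ← integral_sub hint_reward hint2, ← integral_sub hint_elbo hint4]
  refine integral_congr_ae (.of_forall fun x => ?_)
  have hkl := sum_mul_sum_div_mul_log_div (fun o => mul_pos (hwpos o) (hcpos o x))
    (fun o => hτpos o x)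
  simp only [hr, hq, hkl]
  rw [sub_sub, add_sub_cancel, ← Finset.sum_sub_distrib]
  refine Finset.sum_congr rfl fun o _ => ?_
  rw [Real.log_mul (hwpos o).ne' (hcpos o x).ne']
  ring
end

section
/- Tightness of the lower bound after the E-step: under the finite mixture setup, if the auxiliary conditional is set to the responsibilities of the mixture itself, τ o x = r o x = w o · c o x / q x, then the lower bound equals the ELBO: J̃(r) = J. -/
open MeasureTheory

/-- Tightness of the lower bound after the E-step: if the auxiliary conditional is set to
the responsibilities of the mixture itself, then the lower bound equals the ELBO:
`J̃(r) = J`. -/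
theorem lowerBound_responsibilities_eq_elbo
    {X : Type*} [MeasurableSpace X] (μ : Measure X)
    {O : Type*} [Fintype O] [Nonempty O]
    (w : O → ℝ) (c : O → X → ℝ) (ρ : X → ℝ)
    -- finite mixture model
    (hwpos : ∀ o, 0 < w o) (hwsum : ∑ o, w o = 1)
    (hcmeas : ∀ o, Measurable (c o)) (hcpos : ∀ o x, 0 < c o x)
    (hcnorm : ∀ o, ∫ x, c o x ∂μ = 1)
    (hρ : Measurable ρ)
    -- mixture density and responsibilities
    (q : X → ℝ) (hq : ∀ x, q x = ∑ o, w o * c o x)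
    (r : O → X → ℝ) (hr : ∀ o x, r o x = w o * c o x / q x)
    -- all integrals appearing exist
    (hintc : ∀ o, Integrable (c o) μ)
    (hint1 : ∀ o, Integrable (fun x => c o x * ρ x) μ)
    (hint2 : Integrable (fun x => q x * Real.log (q x)) μ)
    (hint3 : ∀ o, Integrable
      (fun x => c o x * (ρ x + Real.log (r o x) - Real.log (c o x))) μ) :
    (∑ o, w o * ((∫ x, c o x * (ρ x + Real.log (r o x) - Real.log (c o x)) ∂μ)
        - Real.log (w o)))
      = (∑ o, w o * ∫ x, c o x * ρ x ∂μ) - ∫ x, q x * Real.log (q x) ∂μ := by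
  have hqpos : ∀ x, 0 < q x := fun x => by
    rw [hq]
    exact Finset.sum_pos (fun o _ => mul_pos (hwpos o) (hcpos o x)) Finset.univ_nonempty
  have hsplit : ∀ o x, c o x * (ρ x + Real.log (r o x) - Real.log (c o x))
      = c o x * ρ x + c o x * Real.log (w o) - c o x * Real.log (q x) := fun o x => by
    rw [hr, Real.log_div (mul_pos (hwpos o) (hcpos o x)).ne' (hqpos x).ne',
      Real.log_mul (hwpos o).ne' (hcpos o x).ne']
    ring
  have hsum : ∀ o, Integrable (fun x => c o x * ρ x + c o x * Real.log (w o)) μ := fun o =>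
    (hint1 o).add ((hintc o).mul_const _)
  have hclogq : ∀ o, Integrable (fun x => c o x * Real.log (q x)) μ := fun o =>
    ((hsum o).sub (hint3 o)).congr (.of_forall fun x => by
      simp only [Pi.sub_apply, hsplit]
      ring)
  have hcomponent : ∀ o, ∫ x, c o x * (ρ x + Real.log (r o x) - Real.log (c o x)) ∂μ
      = (∫ x, c o x * ρ x ∂μ) + Real.log (w o) - ∫ x, c o x * Real.log (q x) ∂μ := fun o => by
    simp only [hsplit]
    rw [integral_sub (hsum o) (hclogq o),
      integral_add (hint1 o) ((hintc o).mul_const _), integral_mul_const, hcnorm, one_mul]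
  have hentropy : ∫ x, q x * Real.log (q x) ∂μ
      = ∑ o, w o * ∫ x, c o x * Real.log (q x) ∂μ := by
    simp only [← integral_const_mul]
    rw [← integral_finsetSum _ fun o _ => (hclogq o).const_mul (w o)]
    refine integral_congr_ae (.of_forall fun x => ?_)
    simp only [← mul_assoc, ← Finset.sum_mul, ← hq]
  rw [hentropy, ← Finset.sum_sub_distrib]
  refine Finset.sum_congr rfl fun o _ => ?_
  rw [hcomponent]
  ring
end

section
/- Equivalence of the VIPS and iBayes-GMM weight updates: let K ≥ 1, p : Fin K → ℝ with p o > 0 and ∑_o p o = 1, R̂ : Fin K → ℝ, and η > −1; set β = 1/(1+η) and R o = R̂ o + log (p o). Then the normalized VIPS-updated weights q_V o = p o^{η/(1+η)} · (exp (R o))^{1/(1+η)} / ∑_k p k^{η/(1+η)} · (exp (R k))^{1/(1+η)} coincide with the normalized iBayes-GMM-updated weights q_L o = p o · exp (β · R̂ o) / ∑_k p k · exp (β · R̂ k), i.e., q_V = q_L. (Appendix E: 'it exactly matches the update for β = 1/(1+η_w)'.) -/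
/-- The unnormalized VIPS weight equals the unnormalized iBayes-GMM weight. -/
theorem rpow_mul_exp_add_log_rpow {x η : ℝ} (hx : 0 < x) (hη : 1 + η ≠ 0) (r : ℝ) :
    x ^ (η / (1 + η)) * Real.exp (r + Real.log x) ^ (1 / (1 + η))
      = x * Real.exp (1 / (1 + η) * r) := by
  have hsum : η / (1 + η) + 1 / (1 + η) = 1 := by
    rw [← add_div, add_comm η 1, div_self hη]
  rw [Real.exp_add, Real.exp_log hx, Real.mul_rpow (Real.exp_pos r).le hx.le, mul_left_comm,
    ← Real.rpow_add hx, hsum, Real.rpow_one, ← Real.exp_mul, mul_comm r, mul_comm]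

/-- Equivalence of the VIPS and iBayes-GMM weight updates: with `β = 1/(1+η)` and
`R o = R̂ o + log (p o)`, the normalized VIPS-updated weights coincide with the normalized
iBayes-GMM-updated weights. -/
theorem vips_weight_update_eq_iBayesGMM_weight_update
    {K : ℕ} (hK : 1 ≤ K)
    (p : Fin K → ℝ) (hp : ∀ o, 0 < p o) (hpsum : ∑ o, p o = 1)
    (Rhat : Fin K → ℝ) (η : ℝ) (hη : -1 < η)
    (β : ℝ) (hβ : β = 1 / (1 + η))
    (R : Fin K → ℝ) (hR : ∀ o, R o = Rhat o + Real.log (p o)) :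
    ∀ o, p o ^ (η / (1 + η)) * (Real.exp (R o)) ^ (1 / (1 + η)) /
        (∑ k, p k ^ (η / (1 + η)) * (Real.exp (R k)) ^ (1 / (1 + η)))
      = p o * Real.exp (β * Rhat o) / ∑ k, p k * Real.exp (β * Rhat k) := by
  have hη' : 1 + η ≠ 0 := (by linarith : 0 < 1 + η).ne'
  intro o
  simp only [hR, hβ, rpow_mul_exp_add_log_rpow (hp _) hη']
end

section
/- Structure of the iBLR precision update: let n be a finite index type, let L be an invertible real n × n matrix, R a symmetric real n × n matrix, and β ∈ ℝ. Set P_old = Lᵀ * L, Σ_old = P_old⁻¹, and define the iBLR-updated precision P_new = P_old − (2β) • R + (2β²) • (R * Σ_old * R) (equivalently, −½ P_new = −½ P_old + β (R − β R Σ_old R)). Then with U = L − (2β) • ((Lᵀ)⁻¹ * R), one has P_new = (1/2) • (P_old + Uᵀ * U); i.e., the new precision matrix is the average of the old (positive definite) precision and the positive semidefinite matrix Uᵀ U. (Section 3.3.) -/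
open Matrix

/-- Structure of the iBLR precision update: with `P_old = Lᵀ L`, `Σ_old = P_old⁻¹` and
`U = L − 2β (Lᵀ)⁻¹ R`, the iBLR-updated precision
`P_new = P_old − 2β R + 2β² R Σ_old R` satisfies `P_new = ½ (P_old + Uᵀ U)`, i.e. it is the
average of the old (positive definite) precision and the positive semidefinite matrix
`Uᵀ U`. -/
theorem iblr_precision_update_structure
    {n : Type*} [Fintype n] [DecidableEq n]
    (L R : Matrix n n ℝ) (hL : IsUnit L.det) (hR : R.IsSymm) (β : ℝ) :
    Lᵀ * L - (2 * β) • R + (2 * β ^ 2) • (R * (Lᵀ * L)⁻¹ * R)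
      = (1 / 2 : ℝ) • (Lᵀ * L + (L - (2 * β) • ((Lᵀ)⁻¹ * R))ᵀ *
          (L - (2 * β) • ((Lᵀ)⁻¹ * R))) := by
  have hLT : IsUnit (Lᵀ).det := by rwa [det_transpose]
  have transpose_inv_mul : ((Lᵀ)⁻¹ * R)ᵀ = R * L⁻¹ := by
    rw [transpose_mul, hR.eq, transpose_nonsing_inv, transpose_transpose]
  have cross_left : Lᵀ * ((Lᵀ)⁻¹ * R) = R := mul_nonsing_inv_cancel_left _ _ hLT
  have cross_right : R * L⁻¹ * L = R := nonsing_inv_mul_cancel_right _ _ hL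
  have quadratic : R * (Lᵀ * L)⁻¹ * R = R * L⁻¹ * ((Lᵀ)⁻¹ * R) := by
    simp only [Matrix.mul_inv_rev, Matrix.mul_assoc]
  rw [quadratic, transpose_sub, transpose_smul, transpose_inv_mul, Matrix.sub_mul,
    Matrix.mul_sub, Matrix.mul_sub, Matrix.smul_mul, Matrix.smul_mul, Matrix.mul_smul,
    Matrix.mul_smul, cross_left, cross_right]
  module
end

section
/- The iBLR update preserves positive definiteness of the precision matrix: let n be a finite nonempty index type, L an invertible real n × n matrix, R a symmetric real n × n matrix, and β ∈ ℝ. With P_old = Lᵀ * L and Σ_old = P_old⁻¹, the iBLR-updated precision P_new = P_old − (2β) • R + (2β²) • (R * Σ_old * R) is positive definite. (Section 3.3: the iBLR update 'ensures that the covariance matrix remains positive definite'.) -/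
open Matrix

/-- Completing the square: `P - 2β R + 2β² R P⁻¹ R` is the average of `P` and
`(P - 2β R) P⁻¹ (P - 2β R)`. -/
theorem sub_smul_add_smul_mul_inv_mul_eq
    {n : Type*} [Fintype n] [DecidableEq n] {P : Matrix n n ℝ} (hP : IsUnit P.det)
    (R : Matrix n n ℝ) (β : ℝ) :
    P - (2 * β) • R + (2 * β ^ 2) • (R * P⁻¹ * R) =
      (1 / 2 : ℝ) • P +
        (1 / 2 : ℝ) • ((P - (2 * β) • R) * P⁻¹ * (P - (2 * β) • R)) := by
  simp only [sub_mul, mul_sub, smul_mul_assoc, mul_smul_comm, Matrix.mul_nonsing_inv P hP,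
    Matrix.nonsing_inv_mul_cancel_right P R hP, Matrix.one_mul]
  module

/-- For positive definite `P` and symmetric `R`, the matrix `P - 2β R + 2β² R P⁻¹ R` is
positive definite. -/
theorem posDef_sub_smul_add_smul_mul_inv_mul
    {n : Type*} [Fintype n] [DecidableEq n] {P R : Matrix n n ℝ} (hP : P.PosDef)
    (hR : R.IsSymm) (β : ℝ) :
    (P - (2 * β) • R + (2 * β ^ 2) • (R * P⁻¹ * R)).PosDef := by
  rw [sub_smul_add_smul_mul_inv_mul_eq hP.det_pos.ne'.isUnit]
  have hQ : (P - (2 * β) • R)ᴴ = P - (2 * β) • R := by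
    rw [conjTranspose_sub, hP.isHermitian.eq, conjTranspose_smul,
      conjTranspose_eq_transpose_of_trivial R, hR.eq, star_trivial]
  have hS := hP.inv.posSemidef.conjTranspose_mul_mul_same (P - (2 * β) • R)
  rw [hQ] at hS
  exact (hP.smul (by norm_num)).add_posSemidef (hS.smul (by norm_num))

/-- The iBLR update preserves positive definiteness of the precision matrix: with
`P_old = Lᵀ L` (`L` invertible) and `Σ_old = P_old⁻¹`, the iBLR-updated precision
`P_new = P_old − 2β R + 2β² R Σ_old R` is positive definite, for any symmetric `R` and any
stepsize `β`. -/
theorem iblr_precision_update_posDef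
    {n : Type*} [Fintype n] [DecidableEq n] [Nonempty n]
    (L R : Matrix n n ℝ) (hL : IsUnit L.det) (hR : R.IsSymm) (β : ℝ) :
    (Lᵀ * L - (2 * β) • R + (2 * β ^ 2) • (R * (Lᵀ * L)⁻¹ * R)).PosDef := by
  have hP : (Lᵀ * L).PosDef := by
    rw [← conjTranspose_eq_transpose_of_trivial]
    exact PosDef.conjTranspose_mul_self L
      (mulVec_injective_of_isUnit ((isUnit_iff_isUnit_det L).mpr hL))
  exact posDef_sub_smul_add_smul_mul_inv_mul hP hR β
end
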